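/- Let N ≥ 1, let p ≥ 2 be a real number, let θ ∈ ℝ, and let α, β be real constants with α ≥ 2 and β > 0. Then for every u ∈ C^∞_c(ℝ^N \ {0};ℂ): ∫_{ℝ^N} |∇u(x)·(x/|x|)|^p |x|^{−p(θ−1)} e^{−|x|^α/β} dx ≥ |(N − pθ)/p|^p ∫_{ℝ^N} |u(x)|^p |x|^{−pθ} e^{−|x|^α/β} dx − (α/β)·((N − pθ)/p)·|(N − pθ)/p|^{p−2} ∫_{ℝ^N} |u(x)|^p |x|^{−(pθ−α)} e^{−|x|^α/β} dx. -/

import Mathlib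

open MeasureTheory Real
noncomputable section
open Topology Filter

lemma div_thm {N : ℕ} (G : EuclideanSpace ℝ (Fin N) → ℝ) (hG : ContDiff ℝ 1 G)
    (hc : HasCompactSupport G) :
    Integrable (fun x => fderiv ℝ G x x) ∧ ∫ x, fderiv ℝ G x x = -(N * ∫ x, G x) := by
  have hcont : Continuous (fderiv ℝ G) := hG.continuous_fderiv (by norm_num)
  have hcs : HasCompactSupport (fderiv ℝ G) := hc.fderiv ℝ
  have e1 : ∀ x : EuclideanSpace ℝ (Fin N), fderiv ℝ G x x =
      ∑ i, x i * fderiv ℝ G x (EuclideanSpace.single i 1) := by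
    intro x
    have h := (EuclideanSpace.basisFun (Fin N) ℝ).sum_repr x
    have h2 := congrArg (fderiv ℝ G x) h
    rw [← h2]
    simp
  have hi : ∀ i, Integrable (fun x : EuclideanSpace ℝ (Fin N) => x i * fderiv ℝ G x (EuclideanSpace.single i 1)) := by
    intro i
    apply Continuous.integrable_of_hasCompactSupport
    · fun_prop
    · apply HasCompactSupport.mul_left
      exact hcs.comp_left (g := fun L : EuclideanSpace ℝ (Fin N) →L[ℝ] ℝ => L (EuclideanSpace.single i 1)) (by simp)
  have hd : ∀ (i : Fin N) (x : EuclideanSpace ℝ (Fin N)), fderiv ℝ (fun x : EuclideanSpace ℝ (Fin N) => x i) x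
      = EuclideanSpace.proj i := by
    intro i x
    exact (EuclideanSpace.proj i : EuclideanSpace ℝ (Fin N) →L[ℝ] ℝ).hasFDerivAt.fderiv
  have hGi : Integrable G := hG.continuous.integrable_of_hasCompactSupport hc
  refine ⟨?_, ?_⟩
  · simp_rw [e1]
    exact integrable_finsetSum _ fun i _ => hi i
  · simp_rw [e1]
    rw [integral_finsetSum _ fun i _ => hi i]
    have : ∀ i : Fin N, ∫ x : EuclideanSpace ℝ (Fin N), x i * fderiv ℝ G x (EuclideanSpace.single i 1) = - ∫ x, G x := by
      intro i
      rw [integral_mul_fderiv_eq_neg_fderiv_mul_of_integrable]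
      · simp [hd]
      · simpa [hd] using hGi
      · exact hi i
      · apply Continuous.integrable_of_hasCompactSupport
        · have := hG.continuous
          fun_prop
        · exact hc.mul_left
      · fun_prop
      · exact fun x _ => hG.differentiable (by norm_num) x
    simp [this]

lemma young_aux {p a b : ℝ} (hp : 2 ≤ p) (ha : 0 ≤ a) (hb : 0 ≤ b) :
    p * a ^ (p-1) * b ≤ (p-1) * a ^ p + b ^ p := by
  have h1 : 0 < p - 1 := by linarith
  have hq : (p / (p-1)).HolderConjugate p := by
    rw [Real.holderConjugate_iff]
    refine ⟨by rw [lt_div_iff₀ h1]; linarith, by field_simp; ring⟩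
  have := Real.young_inequality_of_nonneg (Real.rpow_nonneg ha (p-1)) hb hq
  rw [← Real.rpow_mul ha, mul_div_cancel₀ _ h1.ne'] at this
  have h2 := mul_le_mul_of_nonneg_left this (by linarith : 0 ≤ p)
  calc _ = p * (a ^ (p-1) * b) := by ring
    _ ≤ _ := h2
    _ = _ := by field_simp

lemma pw {p c U d T : ℝ} (hp : 2 ≤ p) (hU : 0 ≤ U) (hd : 0 ≤ d) (hT : |T| ≤ U * d) :
    |c| ^ p * U ^ p - d ^ p ≤ c * |c| ^ (p-2) * (p * c * U ^ p + p * U ^ (p-2) * T) := by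
  have hy := young_aux hp (mul_nonneg (abs_nonneg c) hU) hd
  have s : ∀ y : ℝ, 0 ≤ y → y * y ^ (p-2) = y ^ (p-1) := fun y hy => by
    rw [← Real.rpow_one_add' hy (by linarith)]; ring_nf
  have sB : ∀ y : ℝ, 0 ≤ y → y * y ^ (p-1) = y ^ p := fun y hy => by
    rw [← Real.rpow_one_add' hy (by linarith)]; ring_nf
  have c2 : c * c * |c| ^ (p-2) = |c| ^ p := by
    rw [← abs_mul_abs_self, mul_assoc, s _ (abs_nonneg c), sB _ (abs_nonneg c)]
  have hcT : -(|c| ^ (p-1) * U ^ (p-1) * d) ≤ c * |c| ^ (p-2) * (U ^ (p-2) * T) := by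
    apply neg_le_of_abs_le
    rw [abs_mul, abs_mul, abs_mul, abs_of_nonneg (Real.rpow_nonneg (abs_nonneg c) _),
      abs_of_nonneg (Real.rpow_nonneg hU _), s _ (abs_nonneg c), ← s U hU, mul_assoc]
    apply mul_le_mul_of_nonneg_left _ (by positivity)
    calc _ ≤ U ^ (p-2) * (U * d) := by gcongr
      _ = _ := by ring
  rw [Real.mul_rpow (abs_nonneg c) hU, Real.mul_rpow (abs_nonneg c) hU] at hy
  have := mul_le_mul_of_nonneg_left hcT (by linarith : 0 ≤ p)
  have e : c * |c| ^ (p-2) * (p * c * U ^ p + p * U ^ (p-2) * T) =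
    p * |c| ^ p * U ^ p + p * (c * |c| ^ (p-2) * (U ^ (p-2) * T)) := by rw [← c2]; ring
  rw [e]
  nlinarith

lemma radial {E : Type*} [NormedAddCommGroup E] [InnerProductSpace ℝ E] {u : E → ℂ} {x : E}
    (hu : DifferentiableAt ℝ u x) (hx : x ≠ 0) {p s α β : ℝ} (hp : 2 ≤ p) :
    fderiv ℝ (fun x => ‖u x‖ ^ p * ‖x‖ ^ s * Real.exp (-(‖x‖ ^ α) / β)) x x =
      (p * ‖u x‖ ^ (p-2) * inner ℝ (u x) (fderiv ℝ u x x) + s * ‖u x‖ ^ p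
        - α / β * ‖x‖ ^ α * ‖u x‖ ^ p) * (‖x‖ ^ s * Real.exp (-(‖x‖ ^ α) / β)) := by
  have hx0 : ‖x‖ ≠ 0 := norm_ne_zero_iff.mpr hx
  have hn : DifferentiableAt ℝ (fun y : E => ‖y‖) x := differentiableAt_id.norm ℝ hx
  have hself : fderiv ℝ (fun y : E => ‖y‖) x x = ‖x‖ := hn.fderiv_norm_self
  have h1 := (hasFDerivAt_norm_rpow (u x) (by linarith : 1 < p)).comp x hu.hasFDerivAt
  have h2 := hn.hasFDerivAt.rpow_const (p := s) (Or.inl hx0)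
  have h3 := hn.hasFDerivAt.rpow_const (p := α) (Or.inl hx0)
  have h4 := ((h3.neg).mul_const β⁻¹).exp
  have h := (h1.mul h2).mul h4
  have e : (fun x => ‖u x‖ ^ p * ‖x‖ ^ s * Real.exp (-(‖x‖ ^ α) / β)) =
    (fun x => (((fun x : ℂ ↦ ‖x‖ ^ p) ∘ u) x * ‖x‖ ^ s) * Real.exp (-(‖x‖ ^ α) * β⁻¹)) := by
    funext y; simp [div_eq_mul_inv]
  rw [e]
  erw [h.fderiv]
  have a1 : ‖x‖ ^ (α - 1) * ‖x‖ = ‖x‖ ^ α := by rw [Real.rpow_sub_one hx0]; field_simp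
  have a2 : ‖x‖ ^ (s - 1) * ‖x‖ = ‖x‖ ^ s := by rw [Real.rpow_sub_one hx0]; field_simp
  simp [hself]
  rw [← a1, ← a2]
  ring_nf

/-- **Gaussian-type weighted Hardy inequality (type B) in `ℝ^N`** with weight
`|x|^{-p(θ-1)} e^{-|x|^α/β}`, for functions supported away from the origin. -/
theorem hardy_gaussian_B_euclidean
    {N : ℕ} (hN : 1 ≤ N)
    {p : ℝ} (hp : 2 ≤ p) (θ : ℝ)
    {α β : ℝ} (hα : 2 ≤ α) (hβ : 0 < β) :
    ∀ u : EuclideanSpace ℝ (Fin N) → ℂ,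
      ContDiff ℝ (⊤ : ℕ∞) u → HasCompactSupport u →
      tsupport u ⊆ {x : EuclideanSpace ℝ (Fin N) | x ≠ 0} →
      |((N : ℝ) - p * θ) / p| ^ p *
          (∫ x, ‖u x‖ ^ p * ‖x‖ ^ (-(p * θ)) * Real.exp (-(‖x‖ ^ α) / β))
        - (α / β) * (((N : ℝ) - p * θ) / p) * |((N : ℝ) - p * θ) / p| ^ (p - 2) *
          (∫ x, ‖u x‖ ^ p * ‖x‖ ^ (-(p * θ - α)) * Real.exp (-(‖x‖ ^ α) / β))
        ≤ ∫ x, ‖fderiv ℝ u x (‖x‖⁻¹ • x)‖ ^ p * ‖x‖ ^ (-(p * (θ - 1))) *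
            Real.exp (-(‖x‖ ^ α) / β) := by
  intro u hu hc hs
  have hp0 : p ≠ 0 := by linarith
  have hu0 : u =ᶠ[𝓝 0] 0 := by
    rw [← notMem_tsupport_iff_eventuallyEq]
    intro h; exact hs h rfl
  have hu00 : u 0 = 0 := hu0.eq_of_nhds
  have hdu0 : fderiv ℝ u =ᶠ[𝓝 0] 0 := by
    filter_upwards [hu0.eventuallyEq_nhds] with y hy
    rw [hy.fderiv_eq]; simp
  have hdiff : Differentiable ℝ u := hu.differentiable (by simp)
  have hdc : Continuous (fderiv ℝ u) := hu.continuous_fderiv (by simp)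
  set c : ℝ := ((N : ℝ) - p * θ) / p with hcdef
  have hpc : p * c = N - p * θ := by rw [hcdef]; field_simp
  set G : EuclideanSpace ℝ (Fin N) → ℝ :=
    fun x => ‖u x‖ ^ p * ‖x‖ ^ (-(p * θ)) * Real.exp (-(‖x‖ ^ α) / β) with hGdef
  set G2 : EuclideanSpace ℝ (Fin N) → ℝ :=
    fun x => ‖u x‖ ^ p * ‖x‖ ^ (-(p * θ - α)) * Real.exp (-(‖x‖ ^ α) / β) with hG2def
  set G3 : EuclideanSpace ℝ (Fin N) → ℝ :=
    fun x => ‖fderiv ℝ u x (‖x‖⁻¹ • x)‖ ^ p * ‖x‖ ^ (-(p * (θ - 1))) *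
            Real.exp (-(‖x‖ ^ α) / β) with hG3def
  have hGc : HasCompactSupport G := by
    refine hc.mono fun x hx => ?_
    contrapose! hx
    simp only [Function.mem_support, not_not] at hx ⊢
    simp [G, hx, hp0]
  have hG1 : ContDiff ℝ 1 G := by
    rw [contDiff_iff_contDiffAt]
    intro x
    by_cases hx : x = 0
    · subst hx
      have : G =ᶠ[𝓝 0] fun _ => 0 := by
        filter_upwards [hu0] with y hy
        simp [G, hy, hp0]
      exact contDiffAt_const.congr_of_eventuallyEq this
    · have hx0 : ‖x‖ ≠ 0 := norm_ne_zero_iff.mpr hx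
      have hn : ContDiffAt ℝ 1 (fun y : EuclideanSpace ℝ (Fin N) => ‖y‖) x := contDiffAt_norm ℝ hx
      have h1 : ContDiffAt ℝ 1 (fun x => ‖u x‖ ^ p) x :=
        ((contDiff_norm_rpow (by linarith : 1 < p)).comp (hu.of_le (by exact_mod_cast le_top))).contDiffAt
      exact (h1.mul (hn.rpow_const_of_ne hx0)).mul
        (((hn.rpow_const_of_ne hx0).neg.div_const β).exp)
  obtain ⟨hDi, hD⟩ := div_thm G hG1 hGc
  have hGi : Integrable G := hG1.continuous.integrable_of_hasCompactSupport hGc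
  have hG2e : G2 = fun x => ‖x‖ ^ α * G x := by
    funext x
    by_cases hx : x = 0
    · subst hx; simp [G, G2, hu00, hp0]
    · have hx0 : 0 < ‖x‖ := norm_pos_iff.mpr hx
      have : ‖x‖ ^ (-(p * θ - α)) = ‖x‖ ^ α * ‖x‖ ^ (-(p*θ)) := by
        rw [← Real.rpow_add hx0]; ring_nf
      simp only [G, G2, this]; ring
  have hG2i : Integrable G2 := by
    rw [hG2e]
    apply Continuous.integrable_of_hasCompactSupport
    · exact (continuous_norm.rpow_const fun x => Or.inr (by linarith)).mul hG1.continuous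
    · exact hGc.mul_left
  have hG3i : Integrable G3 := by
    apply Continuous.integrable_of_hasCompactSupport
    · rw [continuous_iff_continuousAt]
      intro x
      by_cases hx : x = 0
      · subst hx
        have : G3 =ᶠ[𝓝 0] fun _ => 0 := by
          filter_upwards [hdu0] with y hy
          simp [G3, hy, hp0]
        exact continuousAt_const.congr this.symm
      · have hx0 : ‖x‖ ≠ 0 := norm_ne_zero_iff.mpr hx
        have hn : ContinuousAt (fun y : EuclideanSpace ℝ (Fin N) => ‖y‖) x := continuous_norm.continuousAt
        have hd : ContinuousAt (fun x => fderiv ℝ u x (‖x‖⁻¹ • x)) x :=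
          hdc.continuousAt.clm_apply ((hn.inv₀ hx0).smul continuousAt_id)
        exact ((hd.norm.rpow_const (Or.inr (by linarith))).mul (hn.rpow_const (Or.inl hx0))).mul
          (((hn.rpow_const (Or.inl hx0)).neg.div_const β).rexp)
    · refine (hc.fderiv ℝ).mono fun x hx => ?_
      contrapose! hx
      simp only [Function.mem_support, not_not] at hx ⊢
      simp [G3, hx, hp0]
  have key : ∀ x, |c| ^ p * G x - (α / β) * c * |c| ^ (p-2) * G2 x - G3 x
      ≤ c * |c| ^ (p-2) * (N * G x + fderiv ℝ G x x) := by
    intro x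
    by_cases hx : x = 0
    · subst hx; simp [G, G2, G3, hu00, hp0]
    have hx0 : 0 < ‖x‖ := norm_pos_iff.mpr hx
    set W := ‖x‖ ^ (-(p * θ)) * Real.exp (-(‖x‖ ^ α) / β) with hW
    have hWpos : 0 ≤ W := by positivity
    have eG : G x = ‖u x‖ ^ p * W := by simp only [G, hW]; ring
    have eG2 : G2 x = ‖x‖ ^ α * (‖u x‖ ^ p * W) := by rw [hG2e, ← eG]
    have eG3 : G3 x = ‖fderiv ℝ u x x‖ ^ p * W := by
      have : ‖x‖ ^ (-(p * (θ - 1))) = ‖x‖ ^ p * ‖x‖ ^ (-(p*θ)) := by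
        rw [← Real.rpow_add hx0]; ring_nf
      have h2 : ‖fderiv ℝ u x (‖x‖⁻¹ • x)‖ ^ p * ‖x‖ ^ p = ‖fderiv ℝ u x x‖ ^ p := by
        rw [← Real.mul_rpow (norm_nonneg _) (norm_nonneg _), map_smul, norm_smul]
        congr 1
        rw [norm_inv, norm_norm]; field_simp
      simp only [G3, this, hW, ← h2]; ring
    have eD : fderiv ℝ G x x = (p * ‖u x‖ ^ (p-2) * inner ℝ (u x) (fderiv ℝ u x x)
        + -(p * θ) * ‖u x‖ ^ p - α / β * ‖x‖ ^ α * ‖u x‖ ^ p) * W :=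
      radial (hdiff x) hx hp
    rw [eG, eG2, eG3, eD]
    have := mul_le_mul_of_nonneg_right (pw (c := c) hp (norm_nonneg (u x))
      (norm_nonneg (fderiv ℝ u x x)) (abs_real_inner_le_norm (u x) (fderiv ℝ u x x))) hWpos
    rw [hpc] at this
    linear_combination this
  have hint := integral_mono (((hGi.const_mul (|c| ^ p)).sub
    (hG2i.const_mul ((α / β) * c * |c| ^ (p-2)))).sub hG3i)
    (((hGi.const_mul (N:ℝ)).add hDi).const_mul (c * |c| ^ (p-2))) key
  simp only [Pi.sub_apply, Pi.add_apply] at hint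
  have hsub : Integrable (fun x => |c| ^ p * G x - α / β * c * |c| ^ (p - 2) * G2 x) :=
    (hGi.const_mul _).sub (hG2i.const_mul _)
  rw [integral_sub hsub hG3i,
    integral_sub (hGi.const_mul _) (hG2i.const_mul _), integral_const_mul, integral_const_mul,
    integral_const_mul, integral_add (hGi.const_mul _) hDi, integral_const_mul, hD] at hint
  linarith
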